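/- arXiv:2410.17811 — 3 statements merged into one kernel-verified Lean document; each statement's English description precedes it below -/
import Mathlib

section
/- Let n ≥ 3 and let P ⊂ ℝⁿ be a polytope (the convex hull of a finite set with nonempty interior) containing r·B₂ⁿ for some r with 3√3/√n ≤ r ≤ 1. Let N = N(P, B₂ⁿ) be the covering number of P by Euclidean unit balls, and assume 3 ≤ N and N < e^{n/8}. Then the number |𝓕| of facets of P (its (n−1)-dimensional faces) satisfies |𝓕| > ( 1 / ( 2(1 − r·√(1 − 4·log N / n)) ) )^{(n−1)/2}. -/
open Metric Set MeasureTheory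
open scoped RealInnerProductSpace ENNReal Pointwise

abbrev Euc (n : ℕ) := EuclideanSpace ℝ (Fin n)

/-- The covering number `N(K, T)`: the minimal number of translates of `T`
needed to cover `K`. -/
noncomputable def coveringNumber {n : ℕ} (K T : Set (Euc n)) : ℕ :=
  sInf {N : ℕ | ∃ x : Fin N → Euc n, K ⊆ ⋃ i, x i +ᵥ T}

/-- The radial function `ρ_K(θ) = sup {t ≥ 0 : tθ ∈ K}`. -/
noncomputable def radialFn {n : ℕ} (K : Set (Euc n)) (θ : Euc n) : ℝ :=
  sSup {t : ℝ | 0 ≤ t ∧ t • θ ∈ K}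

/-- The support function `h_K(u) = sup {⟨x, u⟩ : x ∈ K}`. -/
noncomputable def suppFn {n : ℕ} (K : Set (Euc n)) (u : Euc n) : ℝ :=
  sSup ((fun x => ⟪x, u⟫) '' K)

/-- `F` is a facet of `P ⊆ ℝⁿ`: a nonempty exposed face of dimension `n - 1`. -/
def IsFacet {n : ℕ} (P F : Set (Euc n)) : Prop :=
  F.Nonempty ∧ IsExposed ℝ P F ∧ Module.finrank ℝ (vectorSpan ℝ F) = n - 1

open ProbabilityTheory in
lemma gaussianReal_Ici_zero_le : gaussianReal 0 1 (Ici 0) ≤ ENNReal.ofReal (1 / 2) := by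
  have : NullSingletonClass (gaussianReal 0 1) := nullSingletonClass_gaussianReal one_ne_zero
  have hneg : gaussianReal 0 1 (Iic 0) = gaussianReal 0 1 (Ici 0) := by
    have h := gaussianReal_map_neg (μ := 0) (v := 1)
    rw [neg_zero] at h
    conv_lhs => rw [← h]
    rw [Measure.map_apply measurable_neg measurableSet_Iic]
    congr 1
    ext x
    simp
  have hsum : gaussianReal 0 1 (Iic 0) + gaussianReal 0 1 (Ici 0) = 1 := by
    rw [← measure_univ (μ := gaussianReal 0 1), ← Iic_union_Ioi (a := (0 : ℝ)),
      measure_union (by simp) measurableSet_Ioi]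
    congr 1
    exact measure_congr Ioi_ae_eq_Ici.symm
  rw [hneg, ← two_mul] at hsum
  rw [ENNReal.ofReal_div_of_pos two_pos, ENNReal.ofReal_one, ENNReal.ofReal_ofNat,
    ENNReal.le_div_iff_mul_le (by simp) (by simp), mul_comm, hsum]

open ProbabilityTheory in
/-- The sharp Gaussian tail bound `ℙ(g ≥ a) ≤ e^{-a²/2} / 2` for `a ≥ 0`. -/
lemma gaussianReal_Ici_le {a : ℝ} (ha : 0 ≤ a) :
    gaussianReal 0 1 (Ici a) ≤ ENNReal.ofReal (1 / 2 * Real.exp (-a ^ 2 / 2)) := by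
  have hshift : gaussianReal 0 1 (Ici a) = gaussianReal (-a) 1 (Ici 0) := by
    rw [show (-a : ℝ) = 0 - a by ring, ← gaussianReal_map_sub_const (μ := 0) (v := 1) a,
      Measure.map_apply (by fun_prop) measurableSet_Ici]
    congr 1
    ext x
    simp
  rw [hshift, gaussianReal_apply _ one_ne_zero, mul_comm (1 / 2 : ℝ),
    ENNReal.ofReal_mul (Real.exp_pos _).le]
  calc ∫⁻ x in Ici 0, gaussianPDF (-a) 1 x
      ≤ ∫⁻ x in Ici 0, ENNReal.ofReal (Real.exp (-a ^ 2 / 2)) * gaussianPDF 0 1 x := by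
        refine setLIntegral_mono (by fun_prop) fun x hx => ?_
        rw [gaussianPDF, gaussianPDF, ← ENNReal.ofReal_mul (Real.exp_pos _).le]
        refine ENNReal.ofReal_le_ofReal ?_
        rw [gaussianPDFReal, gaussianPDFReal, mul_left_comm, ← Real.exp_add]
        gcongr
        have := mul_nonneg ha (mem_Ici.1 hx)
        simp only [NNReal.coe_one]
        linarith
    _ = ENNReal.ofReal (Real.exp (-a ^ 2 / 2)) * gaussianReal 0 1 (Ici 0) := by
        rw [lintegral_const_mul _ (by fun_prop), gaussianReal_apply _ one_ne_zero]
    _ ≤ _ := by gcongr; exact gaussianReal_Ici_zero_le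

open ProbabilityTheory in
lemma integral_exp_neg_mul_sq_gaussianReal {s : ℝ} (hs : s ^ 2 < 1) :
    ∫ x, Real.exp (-(s ^ 2 / (1 - s ^ 2)) * x ^ 2 / 2) ∂gaussianReal 0 1 = √(1 - s ^ 2) := by
  have hpos : 0 < 1 - s ^ 2 := by linarith
  rw [integral_gaussianReal_eq_integral_smul one_ne_zero]
  have h (x : ℝ) : gaussianPDFReal 0 1 x • Real.exp (-(s ^ 2 / (1 - s ^ 2)) * x ^ 2 / 2) =
      (√(2 * Real.pi))⁻¹ * Real.exp (-(1 / (2 * (1 - s ^ 2))) * x ^ 2) := by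
    rw [gaussianPDFReal, smul_eq_mul, mul_assoc, ← Real.exp_add]
    simp only [NNReal.coe_one, mul_one]
    congr 2
    field_simp
    ring
  simp_rw [h]
  rw [integral_const_mul, integral_gaussian, ← Real.sqrt_inv, ← Real.sqrt_mul (by positivity)]
  congr 1
  field_simp

open ProbabilityTheory in
lemma pi_gaussianReal_cone_le {m : ℕ} {s : ℝ} (hs0 : 0 ≤ s) (hs1 : s < 1) :
    Measure.pi (fun _ : Fin (m + 1) => gaussianReal 0 1) {y | s * √(∑ i, y i ^ 2) ≤ y 0} ≤
      ENNReal.ofReal (1 / 2 * (1 - s ^ 2) ^ ((m : ℝ) / 2)) := by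
  have hs2 : s ^ 2 < 1 := by nlinarith
  have hpos : 0 < 1 - s ^ 2 := by linarith
  set c := s ^ 2 / (1 - s ^ 2) with hc
  have hc0 : 0 ≤ c := by positivity
  set S : Set (ℝ × (Fin m → ℝ)) := {p | √(c * ∑ i, p.2 i ^ 2) ≤ p.1} with hS
  have hSm : MeasurableSet S := measurableSet_le (by fun_prop) (by fun_prop)
  have hsub : {y : Fin (m + 1) → ℝ | s * √(∑ i, y i ^ 2) ≤ y 0} ⊆
      MeasurableEquiv.piFinSuccAbove (fun _ => ℝ) 0 ⁻¹' S := by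
    intro y hy
    have hy : s * √(∑ i, y i ^ 2) ≤ y 0 := hy
    have h0 : 0 ≤ y 0 := le_trans (by positivity) hy
    have hsq := pow_le_pow_left₀ (by positivity) hy 2
    rw [mul_pow, Real.sq_sqrt (by positivity), Fin.sum_univ_succ] at hsq
    change √(c * ∑ i : Fin m, y i.succ ^ 2) ≤ y 0
    refine Real.sqrt_le_iff.2 ⟨h0, ?_⟩
    rw [hc, div_mul_eq_mul_div, div_le_iff₀ hpos]
    linarith
  have hint (z : Fin m → ℝ) : gaussianReal 0 1 ((fun x => (x, z)) ⁻¹' S) ≤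
      ENNReal.ofReal (1 / 2 * ∏ i, Real.exp (-c * z i ^ 2 / 2)) := by
    refine (gaussianReal_Ici_le (Real.sqrt_nonneg (c * ∑ i, z i ^ 2))).trans_eq ?_
    rw [Real.sq_sqrt (by positivity), ← Real.exp_sum, ← Finset.sum_div, ← Finset.mul_sum, neg_mul]
  have hintegrable : Integrable (fun z : Fin m → ℝ => 1 / 2 * ∏ i, Real.exp (-c * z i ^ 2 / 2))
      (Measure.pi fun _ => gaussianReal 0 1) := by
    refine Integrable.of_bound (Continuous.aestronglyMeasurable (by fun_prop)) (1 / 2)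
      (ae_of_all _ fun z => ?_)
    rw [Real.norm_of_nonneg (by positivity)]
    refine mul_le_of_le_one_right (by norm_num) (Finset.prod_le_one (fun _ _ => by positivity) ?_)
    intro i _
    refine Real.exp_le_one_iff.2 ?_
    have := mul_nonneg hc0 (sq_nonneg (z i))
    linarith
  refine (measure_mono hsub).trans ?_
  rw [(measurePreserving_piFinSuccAbove (fun _ : Fin (m + 1) => gaussianReal 0 1)
    0).measure_preimage hSm.nullMeasurableSet, Measure.prod_apply_symm hSm]
  refine (lintegral_mono hint).trans ?_
  rw [← ofReal_integral_eq_lintegral_ofReal hintegrable (ae_of_all _ fun z => by positivity),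
    integral_const_mul, integral_fintype_prod_eq_pow (fun x : ℝ => Real.exp (-c * x ^ 2 / 2)),
    integral_exp_neg_mul_sq_gaussianReal hs2, Fintype.card_fin, Real.sqrt_eq_rpow,
    ← Real.rpow_mul_natCast hpos.le, one_div_mul_eq_div (2 : ℝ) (m : ℝ)]

open ProbabilityTheory in
/-- The standard Gaussian measure (equivalently, the normalised spherical measure) of the cone of
directions whose cosine with a unit vector `u` is at least `s`. -/
lemma stdGaussian_cone_le {m : ℕ} {u : Euc (m + 1)} (hu : ‖u‖ = 1) {s : ℝ} (hs0 : 0 ≤ s)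
    (hs1 : s < 1) :
    stdGaussian (Euc (m + 1)) {x | s * ‖x‖ ≤ ⟪u, x⟫} ≤
      ENNReal.ofReal (1 / 2 * (1 - s ^ 2) ^ ((m : ℝ) / 2)) := by
  obtain ⟨b, hb⟩ : ∃ b : OrthonormalBasis (Fin (m + 1)) ℝ (Euc (m + 1)), b 0 = u := by
    obtain ⟨b, hb⟩ := Orthonormal.exists_orthonormalBasis_extension_of_card_eq (𝕜 := ℝ)
      (E := Euc (m + 1)) (ι := Fin (m + 1)) (by simp) (v := fun _ => u) (s := {0})
      (by simp [orthonormal_subsingleton_iff, hu])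
    exact ⟨b, hb 0 rfl⟩
  rw [stdGaussian_eq_map_pi_orthonormalBasis b, Measure.map_apply (by fun_prop)
    (measurableSet_le (by fun_prop) (by fun_prop))]
  refine (measure_mono fun y hy => ?_).trans (pi_gaussianReal_cone_le hs0 hs1)
  have hy : s * ‖∑ i, y i • b i‖ ≤ ⟪u, ∑ i, y i • b i⟫ := hy
  have hn : ‖∑ i, y i • b i‖ ^ 2 = ∑ i, y i ^ 2 := by
    rw [← b.sum_sq_inner_right]
    simp [b.orthonormal.inner_right_fintype]
  rw [← hb, b.orthonormal.inner_right_fintype, ← Real.sqrt_sq (norm_nonneg (∑ i, y i • b i)),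
    hn] at hy
  exact hy

open ProbabilityTheory in
lemma stdGaussian_submodule_eq_zero {n : ℕ} {W : Submodule ℝ (Euc n)} (hW : W ≠ ⊤) :
    stdGaussian (Euc n) (W : Set (Euc n)) = 0 := by
  obtain ⟨u, huW, hu0⟩ := W.orthogonal.exists_mem_ne_zero_of_ne_bot
    (fun h => hW ((Submodule.orthogonal_eq_bot_iff).1 h))
  have hmap := IsGaussian.map_eq_gaussianReal (μ := stdGaussian (Euc n)) (innerSL ℝ u)
  rw [variance_dual_stdGaussian] at hmap
  have hv : (‖innerSL ℝ u‖ ^ 2).toNNReal ≠ 0 := by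
    simpa [innerSL_apply_norm] using hu0
  have := nullSingletonClass_gaussianReal (μ := (stdGaussian (Euc n))[innerSL ℝ u]) hv
  refine measure_mono_null (t := innerSL ℝ u ⁻¹' {0}) (fun x hx => ?_) ?_
  · simpa using (Submodule.mem_orthogonal' W u).1 huW x hx
  · rw [← Measure.map_apply (by fun_prop) (measurableSet_singleton 0), hmap, measure_singleton]

section Polytope

variable {n : ℕ} {V : Finset (Euc n)} {F : Set (Euc n)}

lemma IsExposed.subset_convexHull_inter
    (hF : IsExposed ℝ (convexHull ℝ (V : Set (Euc n))) F) :
    F ⊆ convexHull ℝ (V ∩ F : Set (Euc n)) := by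
  have hcomp : IsCompact F := hF.isCompact (V.finite_toSet.isCompact_convexHull ℝ)
  have hfin : (V ∩ F : Set (Euc n)).Finite := V.finite_toSet.inter_of_left F
  conv_lhs => rw [← closure_convexHull_extremePoints hcomp (hF.convex (convex_convexHull ℝ _))]
  refine closure_minimal (convexHull_mono fun x hx => ⟨?_, hx.1⟩) (hfin.isClosed_convexHull ℝ)
  exact extremePoints_convexHull_subset (hF.isExtreme.extremePoints_subset_extremePoints hx)

lemma finite_setOf_isFacet_convexHull :
    {F : Set (Euc n) | IsFacet (convexHull ℝ (V : Set (Euc n))) F}.Finite := by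
  refine Set.Finite.of_injOn (f := fun F => (V ∩ F : Set (Euc n))) (t := (V : Set (Euc n)).powerset)
    (fun F _ => inter_subset_left) ?_ V.finite_toSet.finite_subsets
  have aux {F G : Set (Euc n)} (hF : IsExposed ℝ (convexHull ℝ (V : Set (Euc n))) F)
      (hG : IsExposed ℝ (convexHull ℝ (V : Set (Euc n))) G)
      (h : (V ∩ F : Set (Euc n)) = (V ∩ G : Set (Euc n))) : F ⊆ G :=
    hF.subset_convexHull_inter.trans <| h ▸
      convexHull_min inter_subset_right (hG.convex (convex_convexHull ℝ _))
  intro F hF G hG h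
  exact (aux hF.2.1 hG.2.1 h).antisymm (aux hG.2.1 hF.2.1 h.symm)

/-- A facet of a body containing `r·B₂ⁿ` has a unit normal, and lies at distance at least `r` from
the origin. -/
lemma IsFacet.exists_unit_normal {P : Set (Euc n)} (hF : IsFacet P F) (hn : 0 < n) {r : ℝ}
    (hr : 0 < r) (hball : closedBall 0 r ⊆ P) : ∃ u : Euc n, ‖u‖ = 1 ∧ ∀ x ∈ F, r ≤ ⟪u, x⟫ := by
  obtain ⟨hne, hexp, hdim⟩ := hF
  obtain ⟨l, hFl⟩ := hexp hne
  obtain ⟨w, rfl⟩ := (InnerProductSpace.toDual ℝ (Euc n)).surjective l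
  simp only [InnerProductSpace.toDual_apply_apply] at hFl
  have hw : w ≠ 0 := by
    rintro rfl
    obtain rfl : F = P := by simpa using hFl
    have htop : vectorSpan ℝ F = ⊤ := by
      rw [← direction_affineSpan, affineSpan_eq_top_of_nonempty_interior,
        AffineSubspace.direction_top]
      exact ⟨0, mem_interior_iff_mem_nhds.2 (Filter.mem_of_superset (closedBall_mem_nhds 0 hr)
        (hball.trans (subset_convexHull ℝ F)))⟩
    rw [htop, finrank_top, finrank_euclideanSpace, Fintype.card_fin] at hdim
    omega
  have hw' : 0 < ‖w‖ := norm_pos_iff.2 hw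
  refine ⟨‖w‖⁻¹ • w, norm_smul_inv_norm hw, fun x hx => ?_⟩
  have hmem : (r * ‖w‖⁻¹) • w ∈ P := by
    refine hball (mem_closedBall_zero_iff.2 ?_)
    rw [norm_smul, Real.norm_of_nonneg (by positivity), inv_mul_cancel_right₀ hw'.ne']
  rw [hFl] at hx
  have := hx.2 _ hmem
  rw [real_inner_smul_right, real_inner_self_eq_norm_sq] at this
  rw [real_inner_smul_left, inv_mul_eq_div, le_div_iff₀ hw']
  calc r * ‖w‖ = r * ‖w‖⁻¹ * ‖w‖ ^ 2 := by field_simp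
    _ ≤ _ := this

/-- A ray in general position with respect to the vertices of a polytope leaves the polytope
through a facet. -/
lemma exists_isFacet_gauge_inv_smul_mem (hn : 0 < n)
    (h0 : convexHull ℝ (V : Set (Euc n)) ∈ nhds 0) {x : Euc n}
    (hx : ∀ W ⊆ V, Submodule.span ℝ (W : Set (Euc n)) ≠ ⊤ →
      x ∉ Submodule.span ℝ (W : Set (Euc n))) :
    0 < gauge (convexHull ℝ (V : Set (Euc n))) x ∧
      ∃ F, IsFacet (convexHull ℝ (V : Set (Euc n))) F ∧
        (gauge (convexHull ℝ (V : Set (Euc n))) x)⁻¹ • x ∈ F := by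
  classical
  set P := convexHull ℝ (V : Set (Euc n)) with hP
  have hconv : Convex ℝ P := convex_convexHull ℝ _
  have hcomp : IsCompact P := V.finite_toSet.isCompact_convexHull ℝ
  have hx0 : x ≠ 0 := by
    have : Nonempty (Fin n) := ⟨⟨0, hn⟩⟩
    have := hx ∅ (by simp) (by simp [bot_ne_top])
    simpa using this
  have hg : 0 < gauge P x :=
    (gauge_pos (absorbent_nhds_zero h0) (NormedSpace.isVonNBounded_of_isBounded ℝ hcomp.isBounded)).2
      hx0
  refine ⟨hg, ?_⟩
  set p := (gauge P x)⁻¹ • x with hp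
  have hxp : x = gauge P x • p := by rw [hp, smul_inv_smul₀ hg.ne']
  have hgp : gauge P p = 1 := by
    rw [hp, gauge_smul_of_nonneg (by positivity), smul_eq_mul, inv_mul_cancel₀ hg.ne']
  have hpfr := (gauge_eq_one_iff_mem_frontier hconv h0).1 hgp
  have hpP : p ∈ P := hcomp.isClosed.frontier_subset hpfr
  have h0int : (0 : Euc n) ∈ interior P := mem_interior_iff_mem_nhds.2 h0
  obtain ⟨l, hl⟩ := geometric_hahn_banach_open_point hconv.interior isOpen_interior hpfr.2
  have hlp : 0 < l p := by simpa using hl 0 h0int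
  have hle : ∀ y ∈ P, l y ≤ l p := by
    intro y hy
    have hy' : y ∈ closure (interior P) := by
      rw [hconv.closure_interior_eq_closure_of_nonempty_interior ⟨0, h0int⟩]
      exact subset_closure hy
    exact le_on_closure (fun a ha => (hl a ha).le) l.continuous.continuousOn continuousOn_const hy'
  have hexp : IsExposed ℝ P (l.toExposed P) := ContinuousLinearMap.toExposed.isExposed
  set F := l.toExposed P with hF
  have hpF : p ∈ F := ⟨hpP, hle⟩
  refine ⟨F, ⟨⟨p, hpF⟩, hexp, ?_⟩, hpF⟩
  have hlF : ∀ y ∈ F, l y = l p := fun y hy => le_antisymm (hle y hy.1) (hy.2 p hpP)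
  have hspan : Submodule.span ℝ F = ⊤ := by
    by_contra hne
    refine hx (V.filter (· ∈ F)) (Finset.filter_subset _ _) (fun h => hne ?_) ?_
    · rw [eq_top_iff, ← h]
      exact Submodule.span_mono fun y hy => (Finset.mem_filter.1 (Finset.mem_coe.1 hy)).2
    · rw [hxp]
      refine Submodule.smul_mem _ _ (convexHull_min Submodule.subset_span (Submodule.convex _) ?_)
      convert! hexp.subset_convexHull_inter hpF using 2
      ext y
      simp
  have hlt : Module.finrank ℝ (vectorSpan ℝ F) < n := by
    have hker : vectorSpan ℝ F ≤ LinearMap.ker (l : Euc n →ₗ[ℝ] ℝ) := by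
      rw [vectorSpan, Submodule.span_le]
      rintro _ ⟨a, ha, b, hb, rfl⟩
      simp [hlF a ha, hlF b hb]
    have hne : vectorSpan ℝ F ≠ ⊤ := by
      intro h
      have : p ∈ vectorSpan ℝ F := h ▸ Submodule.mem_top
      exact hlp.ne' (hker this)
    simpa using Submodule.finrank_lt hne
  have hle_sup : (⊤ : Submodule ℝ (Euc n)) ≤ vectorSpan ℝ F ⊔ Submodule.span ℝ {p} := by
    rw [← hspan, Submodule.span_le]
    intro y hy
    rw [← sub_add_cancel y p]
    exact Submodule.add_mem_sup (vsub_mem_vectorSpan ℝ hy hpF) (Submodule.mem_span_singleton_self p)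
  have hge := (Submodule.finrank_mono hle_sup).trans (Submodule.finrank_add_le_finrank_add_finrank _ _)
  have hp0 : p ≠ 0 := fun h => hlp.ne' (by rw [h, map_zero])
  rw [finrank_top, finrank_euclideanSpace, Fintype.card_fin, finrank_span_singleton hp0] at hge
  omega

end Polytope

/-- If a point of norm `√(1 + a²)` lies in a unit ball centred at `c`, its direction makes a small
angle with `c`. -/
lemma mul_norm_le_inner_of_mem_vadd_closedBall {n : ℕ} {c p : Euc n} {a : ℝ}
    (hp : ‖p‖ ^ 2 = 1 + a ^ 2) (hmem : p ∈ c +ᵥ closedBall (0 : Euc n) 1) :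
    a * ‖c‖ ≤ ⟪c, p⟫ := by
  have h1 : ‖p - c‖ ≤ 1 := by
    simpa [vadd_closedBall, dist_eq_norm] using hmem
  have h2 : ‖p - c‖ ^ 2 ≤ 1 := pow_le_one₀ (norm_nonneg _) h1
  rw [norm_sub_sq_real, hp, real_inner_comm] at h2
  nlinarith [sq_nonneg (a - ‖c‖)]

lemma mul_one_sub_rpow_lt_one {n : ℕ} (hn : 3 ≤ n) {N : ℝ} (hN : 1 < N)
    (hq : 0 < 1 - 4 * Real.log N / n) :
    N * (1 - 4 * Real.log N / n) ^ (((n : ℝ) - 1) / 2) < 1 := by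
  have hn' : (3 : ℝ) ≤ n := by exact_mod_cast hn
  have hL : 0 < Real.log N := Real.log_pos hN
  set L := Real.log N with hLdef
  have hexp : (1 - 4 * L / n) ^ (((n : ℝ) - 1) / 2) ≤
      Real.exp (-(4 * L / n) * (((n : ℝ) - 1) / 2)) := by
    rw [Real.exp_mul]
    refine Real.rpow_le_rpow hq.le ?_ (by linarith)
    have := Real.add_one_le_exp (-(4 * L / n))
    linarith
  calc N * (1 - 4 * L / n) ^ (((n : ℝ) - 1) / 2)
      ≤ Real.exp L * Real.exp (-(4 * L / n) * (((n : ℝ) - 1) / 2)) := by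
        rw [hLdef, Real.exp_log (by linarith)]
        gcongr
    _ = Real.exp (L * (2 - n) / n) := by
        rw [← Real.exp_add]
        congr 1
        field_simp
        ring
    _ < 1 := by
        rw [Real.exp_lt_one_iff]
        exact div_neg_of_neg_of_pos (mul_neg_of_pos_of_neg hL (by linarith)) (by linarith)

lemma rpow_one_div_two_mul_one_sub_lt {f s k : ℝ} (hk : 0 ≤ k) (hs0 : 0 ≤ s) (hs1 : s < 1)
    (h : 1 < f * (1 - s ^ 2) ^ k) : (1 / (2 * (1 - s))) ^ k < f := by
  have hpos : 0 < 1 - s ^ 2 := by nlinarith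
  calc (1 / (2 * (1 - s))) ^ k ≤ (1 / (1 - s ^ 2)) ^ k := by
        refine Real.rpow_le_rpow (by have := sub_pos.2 hs1; positivity) ?_ hk
        exact one_div_le_one_div_of_le hpos (by nlinarith [sq_nonneg (1 - s)])
    _ = 1 / (1 - s ^ 2) ^ k := by rw [Real.div_rpow zero_le_one hpos.le, Real.one_rpow]
    _ < f := by rwa [div_lt_iff₀ (Real.rpow_pos_of_pos hpos k)]

open ProbabilityTheory in
/-- If finitely many cones of half-angles `arccos s₀` and `arccos s` cover almost all directions,
then they are numerous. -/
lemma one_le_of_union_cones {m : ℕ} {ι κ : Type*} [Fintype ι] [Fintype κ]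
    {A : Set (Euc (m + 1))} (hA : stdGaussian (Euc (m + 1)) A = 0)
    {v : ι → Euc (m + 1)} {u : κ → Euc (m + 1)} (hu : ∀ j, ‖u j‖ = 1)
    {s₀ s : ℝ} (hs₀ : 0 ≤ s₀) (hs₀' : s₀ < 1) (hs : 0 ≤ s) (hs' : s < 1)
    (hcover : ∀ x ∉ A, (∃ i, v i ≠ 0 ∧ s₀ * ‖v i‖ * ‖x‖ ≤ ⟪v i, x⟫) ∨
      ∃ j, s * ‖x‖ ≤ ⟪u j, x⟫) :
    1 ≤ Fintype.card ι * (1 / 2 * (1 - s₀ ^ 2) ^ ((m : ℝ) / 2)) +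
      Fintype.card κ * (1 / 2 * (1 - s ^ 2) ^ ((m : ℝ) / 2)) := by
  have hpos₀ : 0 ≤ 1 - s₀ ^ 2 := by nlinarith
  have hpos : 0 ≤ 1 - s ^ 2 := by nlinarith
  set γ := stdGaussian (Euc (m + 1))
  set C : ι → Set (Euc (m + 1)) := fun i => {x | v i ≠ 0 ∧ s₀ * ‖v i‖ * ‖x‖ ≤ ⟪v i, x⟫} with hC
  set D : κ → Set (Euc (m + 1)) := fun j => {x | s * ‖x‖ ≤ ⟪u j, x⟫} with hD
  have hCi (i : ι) : γ (C i) ≤ ENNReal.ofReal (1 / 2 * (1 - s₀ ^ 2) ^ ((m : ℝ) / 2)) := by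
    by_cases hi : v i = 0
    · simp [hC, hi]
    refine (measure_mono fun x hx => ?_).trans
      (stdGaussian_cone_le (u := ‖v i‖⁻¹ • v i) (norm_smul_inv_norm hi) hs₀ hs₀')
    change s₀ * ‖x‖ ≤ ⟪‖v i‖⁻¹ • v i, x⟫
    rw [real_inner_smul_left, inv_mul_eq_div, le_div_iff₀ (norm_pos_iff.2 hi)]
    linarith [hx.2]
  have huniv : (univ : Set (Euc (m + 1))) ⊆ A ∪ ((⋃ i, C i) ∪ ⋃ j, D j) := by
    intro x _
    by_cases hx : x ∈ A
    · exact Or.inl hx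
    · exact Or.inr ((hcover x hx).imp mem_iUnion.2 mem_iUnion.2)
  have hmeas : (1 : ℝ≥0∞) ≤ ENNReal.ofReal
      (Fintype.card ι * (1 / 2 * (1 - s₀ ^ 2) ^ ((m : ℝ) / 2)) +
        Fintype.card κ * (1 / 2 * (1 - s ^ 2) ^ ((m : ℝ) / 2))) := by
    calc (1 : ℝ≥0∞) = γ univ := measure_univ.symm
      _ ≤ γ A + (γ (⋃ i, C i) + γ (⋃ j, D j)) :=
          (measure_mono huniv).trans <| (measure_union_le _ _).trans <| by
            gcongr; exact measure_union_le _ _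
      _ ≤ 0 + (∑ i, γ (C i) + ∑ j, γ (D j)) := by
          rw [hA]
          gcongr <;> exact measure_iUnion_fintype_le _ _
      _ ≤ 0 + (∑ _i : ι, ENNReal.ofReal (1 / 2 * (1 - s₀ ^ 2) ^ ((m : ℝ) / 2)) +
            ∑ _j : κ, ENNReal.ofReal (1 / 2 * (1 - s ^ 2) ^ ((m : ℝ) / 2))) := by
          gcongr with i _ j _
          · exact hCi i
          · exact stdGaussian_cone_le (hu j) hs hs'
      _ = _ := by
          rw [ENNReal.ofReal_add (by positivity) (by positivity),
            ENNReal.ofReal_mul (by positivity), ENNReal.ofReal_mul (Nat.cast_nonneg _)]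
          simp
  exact ENNReal.one_le_ofReal.1 hmeas

/-- **Main theorem.** If `P ⊆ ℝⁿ` (`n ≥ 3`) is a polytope containing `r·B₂ⁿ` with
`3√3/√n ≤ r ≤ 1`, and its covering number `N = N(P, B₂ⁿ)` satisfies `3 ≤ N < e^{n/8}`,
then the number of facets of `P` exceeds
`(1 / (2(1 − r√(1 − 4 log N / n))))^{(n−1)/2}`. -/
theorem main_theorem {n : ℕ} (hn : 3 ≤ n)
    (V : Finset (Euc n)) (P : Set (Euc n)) (hP : P = convexHull ℝ (V : Set (Euc n)))
    (hPint : (interior P).Nonempty)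
    (r : ℝ) (hr1 : 3 * Real.sqrt 3 / Real.sqrt n ≤ r) (hr2 : r ≤ 1)
    (hball : closedBall (0 : Euc n) r ⊆ P)
    (N : ℕ) (hN : N = coveringNumber P (closedBall (0 : Euc n) 1))
    (hN3 : 3 ≤ N) (hNexp : (N : ℝ) < Real.exp (n / 8)) :
    ({F : Set (Euc n) | IsFacet P F}.ncard : ℝ) >
      (1 / (2 * (1 - r * Real.sqrt (1 - 4 * Real.log N / n)))) ^ (((n : ℝ) - 1) / 2) := by
  subst hP
  set P := convexHull ℝ (V : Set (Euc n)) with hP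
  obtain ⟨m, rfl⟩ : ∃ m, n = m + 1 := ⟨n - 1, by omega⟩
  have hr : 0 < r := lt_of_lt_of_le (by positivity) hr1
  have hnhds : P ∈ nhds 0 := Filter.mem_of_superset (closedBall_mem_nhds 0 hr) hball
  have hN1 : (1 : ℝ) < N := by exact_mod_cast (by omega : 1 < N)
  have hL : 0 < Real.log N := Real.log_pos hN1
  have hL8 : Real.log N < ((m + 1 : ℕ) : ℝ) / 8 := (Real.log_lt_iff_lt_exp (by linarith)).2 hNexp
  have hn0 : (0 : ℝ) < ((m + 1 : ℕ) : ℝ) := by positivity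
  obtain ⟨c, hc⟩ : ∃ c : Fin N → Euc (m + 1), P ⊆ ⋃ i, c i +ᵥ closedBall (0 : Euc (m + 1)) 1 := by
    rw [hN]
    refine Nat.sInf_mem (s := {N : ℕ | ∃ x : Fin N → Euc (m + 1),
      P ⊆ ⋃ i, x i +ᵥ closedBall (0 : Euc (m + 1)) 1}) (Nat.nonempty_of_pos_sInf ?_)
    change 0 < coveringNumber P (closedBall (0 : Euc (m + 1)) 1)
    omega
  have hNq := mul_one_sub_rpow_lt_one hn hN1 (by
    rw [sub_pos, div_lt_one hn0]; linarith)
  set q := 1 - 4 * Real.log N / ((m + 1 : ℕ) : ℝ) with hq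
  have hq0 : 0 < q := by rw [hq, sub_pos, div_lt_one hn0]; linarith
  have hq1 : q < 1 := by rw [hq, sub_lt_self_iff]; positivity
  have hρ0 : 0 < √q := Real.sqrt_pos.2 hq0
  have hρ1 : √q < 1 := by rwa [Real.sqrt_lt' one_pos, one_pow]
  have hfin : {F : Set (Euc (m + 1)) | IsFacet P F}.Finite := finite_setOf_isFacet_convexHull
  have := hfin.fintype
  choose u hu hur using fun F : {F : Set (Euc (m + 1)) | IsFacet P F} =>
    F.2.exists_unit_normal m.succ_pos hr hball
  set A : Set (Euc (m + 1)) := ⋃ W ∈ {W : Finset (Euc (m + 1)) | W ⊆ V ∧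
    Submodule.span ℝ (W : Set (Euc (m + 1))) ≠ ⊤},
      (Submodule.span ℝ (W : Set (Euc (m + 1))) : Set (Euc (m + 1))) with hA
  have hA0 : ProbabilityTheory.stdGaussian (Euc (m + 1)) A = 0 :=
    (measure_biUnion_null_iff (V.powerset.finite_toSet.subset fun W hW =>
      Finset.mem_coe.2 (Finset.mem_powerset.2 hW.1)).countable).2
        fun W hW => stdGaussian_submodule_eq_zero hW.2
  have hcover : ∀ x ∉ A, (∃ i, c i ≠ 0 ∧ √(1 - q) * ‖c i‖ * ‖x‖ ≤ ⟪c i, x⟫) ∨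
      ∃ F, r * √q * ‖x‖ ≤ ⟪u F, x⟫ := by
    intro x hx
    obtain ⟨hg, F, hF, hxF⟩ := exists_isFacet_gauge_inv_smul_mem m.succ_pos hnhds (x := x)
      fun W hW hW' hxW => hx (mem_iUnion₂.2 ⟨W, ⟨hW, hW'⟩, hxW⟩)
    have hx0 : 0 < ‖x‖ := norm_pos_iff.2 (by rintro rfl; simp at hg)
    have hden : 0 < √q * ‖x‖ := by positivity
    by_cases hp : (√q * ‖x‖)⁻¹ • x ∈ P
    · left
      obtain ⟨i, hi⟩ := mem_iUnion.1 (hc hp)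
      have hnorm : ‖(√q * ‖x‖)⁻¹ • x‖ ^ 2 = 1 + (√(1 - q) / √q) ^ 2 := by
        rw [norm_smul, Real.norm_of_nonneg (by positivity), mul_pow, inv_pow, mul_pow, div_pow,
          Real.sq_sqrt hq0.le, Real.sq_sqrt (by linarith)]
        field_simp
        ring
      refine ⟨i, ?_, ?_⟩
      · intro h0
        rw [h0, zero_vadd, mem_closedBall_zero_iff] at hi
        have h1 := pow_le_one₀ (n := 2) (norm_nonneg _) hi
        rw [hnorm] at h1
        have : 0 < √(1 - q) := Real.sqrt_pos.2 (by linarith)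
        have : 0 < (√(1 - q) / √q) ^ 2 := by positivity
        linarith
      · have h1 := mul_norm_le_inner_of_mem_vadd_closedBall hnorm hi
        rw [real_inner_smul_right, inv_mul_eq_div, le_div_iff₀ hden] at h1
        calc √(1 - q) * ‖c i‖ * ‖x‖ = √(1 - q) / √q * ‖c i‖ * (√q * ‖x‖) := by field_simp
          _ ≤ _ := h1
    · right
      refine ⟨⟨F, hF⟩, ?_⟩
      have hgauge : 1 ≤ gauge P ((√q * ‖x‖)⁻¹ • x) := by
        by_contra! h
        exact hp (interior_subset
          ((gauge_lt_one_iff_mem_interior (convex_convexHull ℝ _) hnhds).1 h))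
      rw [gauge_smul_of_nonneg (by positivity), smul_eq_mul, inv_mul_eq_div, one_le_div hden]
        at hgauge
      have h1 := hur ⟨F, hF⟩ _ hxF
      rw [real_inner_smul_right, inv_mul_eq_div, le_div_iff₀ hg] at h1
      calc r * √q * ‖x‖ = r * (√q * ‖x‖) := by ring
        _ ≤ r * gauge P x := by gcongr
        _ ≤ _ := h1
  have hs1 : r * √q < 1 := (mul_le_of_le_one_left hρ0.le hr2).trans_lt hρ1
  have hmain := one_le_of_union_cones hA0 hu (Real.sqrt_nonneg (1 - q))
    (by rw [Real.sqrt_lt' one_pos]; linarith) (by positivity) hs1 hcover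
  rw [Real.sq_sqrt (by linarith), sub_sub_cancel, Fintype.card_fin, ← Nat.card_eq_fintype_card,
    Nat.card_coe_set_eq] at hmain
  have hm : (((m + 1 : ℕ) : ℝ) - 1) / 2 = (m : ℝ) / 2 := by push_cast; ring
  rw [hm] at hNq ⊢
  exact rpow_one_div_two_mul_one_sub_lt (by positivity) (by positivity) hs1 (by linarith)
end

section
/- Let n ≥ 3 and let P ⊂ ℝⁿ be a polytope containing the Euclidean unit ball B₂ⁿ. Let N = N(P, B₂ⁿ) be the covering number of P by Euclidean unit balls, and assume 3 ≤ N and N < e^{n/8}. Then the number |𝓕| of facets of P satisfies |𝓕| ≥ ( n / (8·log N) )^{(n−1)/2}. -/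
open Metric Set MeasureTheory
open scoped RealInnerProductSpace ENNReal Pointwise

/-- The polar of a set `S`. -/
def polarSet {n : ℕ} (S : Set (Euc n)) : Set (Euc n) :=
  {u | ∀ v ∈ S, ⟪v, u⟫ ≤ 1}

/-- The points of the polar of `S` whose active constraints span the whole space. -/
def polarVertices {n : ℕ} (S : Set (Euc n)) : Set (Euc n) :=
  {u | u ∈ polarSet S ∧ Submodule.span ℝ {v ∈ S | ⟪v, u⟫ = 1} = ⊤}

theorem isClosed_polarSet {n : ℕ} (S : Set (Euc n)) : IsClosed (polarSet S) := by
  simp only [polarSet, ofPred_forall]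
  exact isClosed_biInter fun v _ => isClosed_le (by fun_prop) continuous_const

theorem polarSet_convexHull {n : ℕ} (S : Set (Euc n)) :
    polarSet (convexHull ℝ S) = polarSet S := by
  refine Subset.antisymm (fun u hu v hv => hu v (subset_convexHull ℝ S hv)) fun u hu => ?_
  refine fun y hy => convexHull_min (t := {y | ⟪y, u⟫ ≤ 1}) hu ?_ hy
  refine convex_halfSpace_le ⟨fun x y => inner_add_left x y u, fun c x => ?_⟩ 1
  simp [real_inner_smul_left]

theorem norm_le_one_of_mem_polarSet {n : ℕ} {P : Set (Euc n)}
    (hball : closedBall (0 : Euc n) 1 ⊆ P) {u : Euc n} (hu : u ∈ polarSet P) : ‖u‖ ≤ 1 := by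
  rcases eq_or_ne u 0 with rfl | h0
  · simp
  have hn : ‖u‖ ≠ 0 := norm_ne_zero_iff.2 h0
  have h := hu (‖u‖⁻¹ • u) (hball (by simp [norm_smul, hn]))
  rw [real_inner_smul_left, real_inner_self_eq_norm_sq, sq, inv_mul_cancel_left₀ hn] at h
  exact h

/-- An extreme point of the polar of a finite set has spanning active constraints. -/
theorem extremePoints_polarSet_subset {n : ℕ} (V : Finset (Euc n)) :
    (polarSet (V : Set (Euc n))).extremePoints ℝ ⊆ polarVertices (V : Set (Euc n)) := by
  intro u hu
  rw [mem_extremePoints] at hu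
  refine ⟨hu.1, ?_⟩
  by_contra hspan
  rw [← Submodule.orthogonal_eq_bot_iff] at hspan
  obtain ⟨w, hw, hw0⟩ := Submodule.exists_mem_ne_zero_of_ne_bot hspan
  have hev : ∀ᶠ ε in nhds (0 : ℝ), u + ε • w ∈ polarSet (V : Set (Euc n)) := by
    refine (Filter.eventually_all_finset V).2 fun v hv => ?_
    rcases (hu.1 v hv).lt_or_eq with h | h
    · have hc : Filter.Tendsto (fun ε : ℝ => ⟪v, u + ε • w⟫) (nhds 0) (nhds ⟪v, u⟫) := by
        have : Continuous (fun ε : ℝ => ⟪v, u + ε • w⟫) := by fun_prop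
        simpa using this.tendsto 0
      filter_upwards [hc.eventually_lt_const h] with ε hε using hε.le
    · have h' : ⟪v, w⟫ = 0 := hw v (Submodule.subset_span ⟨hv, h⟩)
      filter_upwards with ε
      simp [inner_add_right, real_inner_smul_right, h, h']
  obtain ⟨δ, hδ, hball⟩ := Metric.eventually_nhds_iff.1 hev
  have h1 := @hball (δ / 2) (by simp [abs_of_pos hδ, hδ])
  have h2 := @hball (-(δ / 2)) (by simp [abs_of_pos hδ, hδ])
  have h3 := (hu.2 _ h1 _ h2 ⟨1 / 2, 1 / 2, by norm_num, by norm_num, by norm_num, by module⟩).1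
  have h4 : (δ / 2) • w = 0 := by simpa using h3
  rcases smul_eq_zero.1 h4 with h | h
  · linarith
  · exact hw0 h

/-- A point outside a polytope containing the unit ball is cut off by a vertex of the polar. -/
theorem exists_polarVertices_one_lt_inner {n : ℕ} (V : Finset (Euc n))
    (hball : closedBall (0 : Euc n) 1 ⊆ convexHull ℝ (V : Set (Euc n))) {x : Euc n}
    (hx : x ∉ convexHull ℝ (V : Set (Euc n))) :
    ∃ u ∈ polarVertices (V : Set (Euc n)), 1 < ⟪x, u⟫ := by
  have hcl : IsClosed (convexHull ℝ (V : Set (Euc n))) :=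
    (V.finite_toSet.isCompact_convexHull (𝕜 := ℝ)).isClosed
  have hQ : IsCompact (polarSet (V : Set (Euc n))) := by
    refine (isCompact_closedBall (0 : Euc n) 1).of_isClosed_subset (isClosed_polarSet _) ?_
    intro u hu
    rw [← polarSet_convexHull] at hu
    simpa using norm_le_one_of_mem_polarSet hball hu
  obtain ⟨f, s, hf, hs⟩ := geometric_hahn_banach_closed_point (convex_convexHull ℝ _) hcl hx
  have hs0 : 0 < s := by simpa using hf 0 (hball (by simp))
  set u₀ := (InnerProductSpace.toDual ℝ (Euc n)).symm (s⁻¹ • f) with hu₀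
  have hin : ∀ y, ⟪y, u₀⟫ = s⁻¹ * f y := fun y => by
    rw [real_inner_comm, hu₀, InnerProductSpace.toDual_symm_apply]; simp
  have hu₀Q : u₀ ∈ polarSet (V : Set (Euc n)) := fun v hv => by
    rw [hin, inv_mul_le_iff₀ hs0, mul_one]
    exact (hf v (subset_convexHull ℝ _ hv)).le
  have hu₀x : 1 < ⟪x, u₀⟫ := by
    rw [hin, lt_inv_mul_iff₀ hs0, mul_one]
    exact hs
  obtain ⟨m, hmQ, hm⟩ := hQ.exists_isMaxOn ⟨u₀, hu₀Q⟩
    (f := fun u => ⟪x, u⟫) (by fun_prop)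
  have hexp := ContinuousLinearMap.toExposed.isExposed (l := innerSL ℝ x)
    (A := polarSet (V : Set (Euc n)))
  obtain ⟨u, hu⟩ := (hexp.isCompact hQ).extremePoints_nonempty ⟨m, hmQ, fun y hy => hm hy⟩
  refine ⟨u, extremePoints_polarSet_subset V
    (hexp.isExtreme.extremePoints_subset_extremePoints hu), hu₀x.trans_le ?_⟩
  exact hu.1.2 u₀ hu₀Q

/-- A vertex of the polar cuts out a facet. -/
theorem isFacet_of_mem_polarVertices {n : ℕ} (hn : 0 < n) {S : Set (Euc n)} {u : Euc n}
    (hu : u ∈ polarVertices S) :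
    IsFacet (convexHull ℝ S) {y ∈ convexHull ℝ S | ⟪y, u⟫ = 1} := by
  have hpol := hu.1
  rw [← polarSet_convexHull] at hpol
  have hfin : Module.finrank ℝ (Euc n) = n := by simp
  have : Nontrivial (Euc n) := Module.nontrivial_of_finrank_pos (R := ℝ) (by omega)
  set F := {y ∈ convexHull ℝ S | ⟪y, u⟫ = 1} with hF
  have hsub : {v ∈ S | ⟪v, u⟫ = 1} ⊆ F := fun v hv => ⟨subset_convexHull ℝ S hv.1, hv.2⟩
  have hspan : Submodule.span ℝ F = ⊤ := top_unique (hu.2 ▸ Submodule.span_mono hsub)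
  have hne : F.Nonempty := by
    by_contra h
    rw [not_nonempty_iff_eq_empty] at h
    simp [h] at hspan
  obtain ⟨a, ha⟩ := hne
  have hu0 : u ≠ 0 := by
    rintro rfl
    simpa using ha.2
  refine ⟨⟨a, ha⟩, fun _ => ⟨innerSL ℝ u, ?_⟩, le_antisymm ?_ ?_⟩
  · ext y
    simp only [innerSL_apply_apply, real_inner_comm _ u]
    refine ⟨fun hy => ⟨hy.1, fun z hz => ?_⟩, fun hy => ⟨hy.1, ?_⟩⟩
    · rw [hy.2]
      exact hpol z hz
    · exact le_antisymm (hpol y hy.1) (ha.2 ▸ hy.2 a ha.1)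
  · have hle : vectorSpan ℝ F ≤ (Submodule.span ℝ {u})ᗮ := by
      rw [vectorSpan_def, Submodule.span_le]
      rintro _ ⟨y, hy, z, hz, rfl⟩
      rw [SetLike.mem_coe, Submodule.mem_orthogonal_singleton_iff_inner_left]
      simp [inner_sub_left, hy.2, hz.2]
    have h1 := Submodule.finrank_mono hle
    have h2 := Submodule.finrank_add_finrank_orthogonal (Submodule.span ℝ {u})
    rw [finrank_span_singleton hu0, hfin] at h2
    omega
  · have htop : vectorSpan ℝ F ⊔ Submodule.span ℝ {a} = ⊤ := by
      refine top_unique (hspan ▸ Submodule.span_le.2 fun y hy => ?_)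
      have := Submodule.add_mem_sup (vsub_mem_vectorSpan ℝ hy ha)
        (Submodule.mem_span_singleton_self (R := ℝ) a)
      simpa using this
    have h1 := Submodule.finrank_add_le_finrank_add_finrank (vectorSpan ℝ F)
      (Submodule.span ℝ {a})
    have ha0 : a ≠ 0 := by
      rintro rfl
      simpa using ha.2
    rw [htop, finrank_top, hfin, finrank_span_singleton ha0] at h1
    omega

/-- A polytope has finitely many facets. -/
theorem finite_setOf_isFacet {n : ℕ} (V : Finset (Euc n)) :
    {F : Set (Euc n) | IsFacet (convexHull ℝ (V : Set (Euc n))) F}.Finite := by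
  have hcpt := V.finite_toSet.isCompact_convexHull (𝕜 := ℝ)
  refine Finite.of_finite_image (f := extremePoints ℝ) ?_ ?_
  · refine V.finite_toSet.finite_subsets.subset ?_
    rintro _ ⟨F, hF, rfl⟩
    exact hF.2.1.isExtreme.extremePoints_subset_extremePoints.trans extremePoints_convexHull_subset
  · intro F hF G hG h
    have key : ∀ F, IsFacet (convexHull ℝ (V : Set (Euc n))) F →
        closure (convexHull ℝ (F.extremePoints ℝ)) = F := fun F hF =>
      closure_convexHull_extremePoints (hF.2.1.isCompact hcpt)
        (hF.2.1.convex (convex_convexHull ℝ _))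
    rw [← key F hF, ← key G hG, h]

theorem finite_polarVertices_and_ncard_le {n : ℕ} (hn : 0 < n) (V : Finset (Euc n)) :
    (polarVertices (V : Set (Euc n))).Finite ∧ (polarVertices (V : Set (Euc n))).ncard ≤
      {F : Set (Euc n) | IsFacet (convexHull ℝ (V : Set (Euc n))) F}.ncard := by
  set f : Euc n → Set (Euc n) := fun u => {y ∈ convexHull ℝ (V : Set (Euc n)) | ⟪y, u⟫ = 1}
    with hf
  have hmaps : ∀ u ∈ polarVertices (V : Set (Euc n)),
      f u ∈ {F : Set (Euc n) | IsFacet (convexHull ℝ (V : Set (Euc n))) F} :=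
    fun u hu => isFacet_of_mem_polarVertices hn hu
  have hinj : InjOn f (polarVertices (V : Set (Euc n))) := by
    intro u hu w hw h
    have hmem : u - w ∈ (Submodule.span ℝ {v ∈ (V : Set (Euc n)) | ⟪v, u⟫ = 1})ᗮ := by
      rw [Submodule.mem_orthogonal']
      intro y hy
      induction hy using Submodule.span_induction with
      | mem y hy =>
        have hyw : y ∈ f w := h ▸ ⟨subset_convexHull ℝ _ hy.1, hy.2⟩
        rw [real_inner_comm, inner_sub_right, hy.2, hyw.2, sub_self]
      | zero => simp
      | add a b _ _ ha hb => rw [inner_add_right, ha, hb, add_zero]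
      | smul c a _ ha => rw [real_inner_smul_right, ha, mul_zero]
    rw [hu.2, Submodule.top_orthogonal_eq_bot, Submodule.mem_bot] at hmem
    exact sub_eq_zero.1 hmem
  have hfin := finite_setOf_isFacet V
  exact ⟨Finite.of_finite_image (hfin.subset (image_subset_iff.2 hmaps)) hinj,
    ncard_le_ncard_of_injOn f hmaps hinj hfin⟩

/-- Volume comparison for a ball covered by unit balls and balls of radius `r`. -/
theorem pow_le_add_mul_pow_of_closedBall_subset {n N : ℕ} {R r : ℝ} (hR : 0 ≤ R) (hr : 0 ≤ r)
    (x : Fin N → Euc n) (U : Finset (Euc n))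
    (h : closedBall (0 : Euc n) R ⊆ (⋃ i, closedBall (x i) 1) ∪ ⋃ u ∈ U, closedBall u r) :
    R ^ n ≤ N + U.card * r ^ n := by
  have hω : 0 < volume.real (closedBall (0 : Euc n) 1) :=
    ENNReal.toReal_pos (measure_closedBall_pos volume _ one_pos).ne' measure_closedBall_lt_top.ne
  have hfin : Module.finrank ℝ (Euc n) = n := by simp
  have hvol : ∀ (c : Euc n) {s : ℝ}, 0 ≤ s →
      volume.real (closedBall c s) = s ^ n * volume.real (closedBall (0 : Euc n) 1) :=
    fun c s hs => by rw [Measure.addHaar_real_closedBall' _ _ hs, hfin]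
  have hne : volume ((⋃ i, closedBall (x i) 1) ∪ ⋃ u ∈ U, closedBall u r) ≠ ⊤ :=
    (((isCompact_iUnion fun i => isCompact_closedBall (x i) 1).union
      (U.isCompact_biUnion fun u _ => isCompact_closedBall u r)).measure_lt_top).ne
  have h1 : volume.real (closedBall (0 : Euc n) R) ≤
      ∑ i, volume.real (closedBall (x i) 1) + ∑ u ∈ U, volume.real (closedBall u r) :=
    (measureReal_mono h hne).trans <| (measureReal_union_le _ _).trans <|
      add_le_add (measureReal_iUnion_fintype_le _) (measureReal_biUnion_finset_le _ _)
  simp only [hvol _ hR, hvol _ hr, Finset.sum_const,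
    Measure.addHaar_real_closedBall_center _ (x _), Finset.card_univ, Fintype.card_fin,
    nsmul_eq_mul, ← mul_assoc, ← add_mul] at h1
  exact le_of_mul_le_mul_right h1 hω

theorem exp_half_le_one_add {t : ℝ} (h0 : 0 ≤ t) (h1 : t ≤ 1) : Real.exp (t / 2) ≤ 1 + t := by
  have hpos : 0 < 1 + t := by linarith
  rw [← Real.le_log_iff_exp_le hpos]
  refine le_trans ?_ (Real.one_sub_inv_le_log_of_pos hpos)
  have : 1 - (1 + t)⁻¹ = t / (1 + t) := by field_simp; ring
  rw [this]
  exact div_le_div_of_nonneg_left h0 hpos (by linarith)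

/-- If `P ⊆ ℝⁿ` (`n ≥ 3`) is a polytope containing the unit ball `B₂ⁿ`, and its covering
number `N = N(P, B₂ⁿ)` satisfies `3 ≤ N < e^{n/8}`, then the number of facets of `P` is at
least `(n / (8 log N))^{(n−1)/2}`. -/
theorem main_theorem_r_one {n : ℕ} (hn : 3 ≤ n)
    (V : Finset (Euc n)) (P : Set (Euc n)) (hP : P = convexHull ℝ (V : Set (Euc n)))
    (hPint : (interior P).Nonempty)
    (hball : closedBall (0 : Euc n) 1 ⊆ P)
    (N : ℕ) (hN : N = coveringNumber P (closedBall (0 : Euc n) 1))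
    (hN3 : 3 ≤ N) (hNexp : (N : ℝ) < Real.exp (n / 8)) :
    ({F : Set (Euc n) | IsFacet P F}.ncard : ℝ) ≥
      ((n : ℝ) / (8 * Real.log N)) ^ (((n : ℝ) - 1) / 2) := by
  subst hP
  obtain ⟨x, hx⟩ : ∃ x : Fin N → Euc n,
      convexHull ℝ (V : Set (Euc n)) ⊆ ⋃ i, closedBall (x i) 1 := by
    have h := Nat.sInf_mem (Nat.nonempty_of_pos_sInf (by
      change 0 < coveringNumber _ _
      omega : 0 < sInf {M : ℕ | ∃ x : Fin M → Euc n,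
        convexHull ℝ (V : Set (Euc n)) ⊆ ⋃ i, x i +ᵥ closedBall (0 : Euc n) 1}))
    change coveringNumber _ _ ∈ _ at h
    rw [← hN] at h
    simpa using h
  have hN3' : (3 : ℝ) ≤ N := by exact_mod_cast hN3
  have hNpos : (0 : ℝ) < N := by linarith
  have hn3 : (3 : ℝ) ≤ n := by exact_mod_cast hn
  have hL : 0 < Real.log N := Real.log_pos (by linarith)
  have hLn : Real.log N < n / 8 := (Real.log_lt_iff_lt_exp hNpos).2 hNexp
  set t : ℝ := 8 * Real.log N / n with ht
  have ht0 : 0 < t := by positivity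
  have ht1 : t ≤ 1 := by
    rw [ht, div_le_one (by linarith)]
    linarith
  obtain ⟨hfin, hcard⟩ := finite_polarVertices_and_ncard_le (by omega) V
  have hcover : closedBall (0 : Euc n) √(1 + t) ⊆
      (⋃ i, closedBall (x i) 1) ∪ ⋃ u ∈ hfin.toFinset, closedBall u √t := by
    intro y hy
    by_cases hyP : y ∈ convexHull ℝ (V : Set (Euc n))
    · exact Or.inl (hx hyP)
    · obtain ⟨u, hu, hyu⟩ := exists_polarVertices_one_lt_inner V hball hyP
      refine Or.inr (mem_biUnion (hfin.mem_toFinset.2 hu) ?_)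
      have hu1 : ‖u‖ ≤ 1 :=
        norm_le_one_of_mem_polarSet hball ((polarSet_convexHull (V : Set (Euc n))).symm ▸ hu.1)
      rw [mem_closedBall_zero_iff, Real.le_sqrt (norm_nonneg _) (by linarith)] at hy
      rw [mem_closedBall, dist_eq_norm, Real.le_sqrt (norm_nonneg _) ht0.le,
        norm_sub_sq_real]
      nlinarith [norm_nonneg u]
  have hvol := pow_le_add_mul_pow_of_closedBall_subset (Real.sqrt_nonneg _) (Real.sqrt_nonneg _)
    x hfin.toFinset hcover
  rw [← ncard_eq_toFinset_card _ hfin] at hvol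
  have hRn : (N : ℝ) ^ 2 ≤ √(1 + t) ^ n := by
    have h1 : Real.exp (t / 4) ≤ √(1 + t) := by
      refine Real.le_sqrt_of_sq_le ?_
      rw [← Real.exp_nat_mul]
      refine le_of_eq_of_le ?_ (exp_half_le_one_add ht0.le ht1)
      congr 1
      push_cast
      ring
    refine le_of_eq_of_le ?_ (pow_le_pow_left₀ (Real.exp_pos _).le h1 n)
    rw [← Real.exp_nat_mul, show (n : ℝ) * (t / 4) = (2 : ℕ) * Real.log N by
      rw [ht]; push_cast; field_simp; ring, Real.exp_nat_mul, Real.exp_log hNpos]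
  have hrn : 0 < √t ^ n := by positivity
  have hm : 1 / √t ^ n ≤ ((polarVertices (V : Set (Euc n))).ncard : ℝ) := by
    rw [div_le_iff₀ hrn]
    nlinarith
  have hbase : (n : ℝ) / (8 * Real.log N) = t⁻¹ := by rw [ht, inv_div]
  calc ((n : ℝ) / (8 * Real.log N)) ^ (((n : ℝ) - 1) / 2)
      ≤ t⁻¹ ^ ((1 / 2 : ℝ) * n) := by
        rw [hbase]
        exact Real.rpow_le_rpow_of_exponent_le ((one_le_inv₀ ht0).2 ht1) (by linarith)
    _ = 1 / √t ^ n := by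
        rw [Real.rpow_mul (by positivity), Real.rpow_natCast, ← Real.sqrt_eq_rpow,
          Real.sqrt_inv, inv_pow, one_div]
    _ ≤ (polarVertices (V : Set (Euc n))).ncard := hm
    _ ≤ _ := by exact_mod_cast hcard
end

section
/- Let K ⊂ ℝⁿ be a convex body with 0 in its interior, and let N = N(K, B₂ⁿ) be its covering number by Euclidean unit balls. Then for every ε ∈ (0,1), σ({θ ∈ S^{n−1} : ρ_K(θ) ≤ 1/√(1−ε²)}) ≥ 1 − 2·e^{log N − nε²/2}, where σ is the rotation-invariant probability measure on S^{n−1} and ρ_K(θ) = sup{t ≥ 0 : tθ ∈ K} is the radial function of K. -/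
open Metric Set MeasureTheory
open scoped RealInnerProductSpace ENNReal Pointwise

theorem exists_linearIsometryEquiv_apply_eq {n : ℕ} {x y : Euc n} (h : ‖x‖ = ‖y‖) :
    ∃ e : Euc n ≃ₗᵢ[ℝ] Euc n, e x = y :=
  ⟨(ℝ ∙ (x - y))ᗮ.reflection, Submodule.reflection_sub h⟩

theorem ae_norm_eq_one {n : ℕ} {σ : Measure (Euc n)}
    (hσsph : σ (sphere (0 : Euc n) 1)ᶜ = 0) : ∀ᵐ θ ∂σ, ‖θ‖ = 1 := by
  have h : ∀ᵐ θ ∂σ, θ ∈ sphere (0 : Euc n) 1 := hσsph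
  filter_upwards [h] with θ hθ
  simpa using hθ

theorem integrable_exp_inner {n : ℕ} {σ : Measure (Euc n)} [IsProbabilityMeasure σ]
    (hσsph : σ (sphere (0 : Euc n) 1)ᶜ = 0) (x : Euc n) :
    Integrable (fun θ => Real.exp ⟪x, θ⟫) σ := by
  refine Integrable.of_bound (C := Real.exp ‖x‖)
    (by fun_prop) ?_
  filter_upwards [ae_norm_eq_one hσsph] with θ hθ
  rw [Real.norm_eq_abs, Real.abs_exp, Real.exp_le_exp]
  simpa [hθ] using real_inner_le_norm x θ

theorem integral_exp_inner_eq_of_norm_eq {n : ℕ} {σ : Measure (Euc n)}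
    (hσinv : ∀ e : Euc n ≃ₗᵢ[ℝ] Euc n, σ.map e = σ) {x y : Euc n} (h : ‖x‖ = ‖y‖) :
    ∫ θ, Real.exp ⟪x, θ⟫ ∂σ = ∫ θ, Real.exp ⟪y, θ⟫ ∂σ := by
  obtain ⟨e, rfl⟩ := exists_linearIsometryEquiv_apply_eq h
  conv_rhs => rw [← hσinv e]
  rw [integral_map (by fun_prop) (by fun_prop)]
  simp

/-- The vector all of whose coordinates are `± s`, with signs prescribed by `p`. -/
noncomputable def signVector {n : ℕ} (s : ℝ) (p : Fin n → Bool) : Euc n :=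
  WithLp.toLp 2 fun i => if p i then s else -s

theorem norm_signVector {n : ℕ} {s : ℝ} (hs : 0 ≤ s) (p : Fin n → Bool) :
    ‖signVector s p‖ = √n * s := by
  have h (i : Fin n) : ‖signVector s p i‖ ^ 2 = s ^ 2 := by
    by_cases hp : p i <;> simp [signVector, hp]
  rw [EuclideanSpace.norm_eq]
  simp_rw [h]
  simp [Real.sqrt_sq hs]

theorem sum_exp_inner_signVector {n : ℕ} (s : ℝ) (θ : Euc n) :
    ∑ p : Fin n → Bool, Real.exp ⟪signVector s p, θ⟫ = 2 ^ n * ∏ i, Real.cosh (s * θ i) := by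
  have h (i : Fin n) : 2 * Real.cosh (s * θ i) =
      ∑ b : Bool, Real.exp ((if b then s else -s) * θ i) := by
    simp [Real.cosh_eq]
    ring
  have h2 : (2 : ℝ) ^ n = ∏ _i : Fin n, 2 := by simp
  rw [h2, ← Finset.prod_mul_distrib, Finset.prod_congr rfl fun i _ => h i, Finset.prod_univ_sum]
  simp only [Fintype.piFinset_univ, ← Real.exp_sum]
  refine Finset.sum_congr rfl fun p _ => ?_
  simp [signVector, PiLp.inner_apply, mul_comm]

theorem prod_cosh_le_exp {n : ℕ} (s : ℝ) {θ : Euc n} (hθ : ‖θ‖ = 1) :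
    ∏ i, Real.cosh (s * θ i) ≤ Real.exp (s ^ 2 / 2) := by
  have h : ∑ i, (θ i) ^ 2 = 1 := by
    simpa [hθ] using (EuclideanSpace.real_norm_sq_eq θ).symm
  calc ∏ i, Real.cosh (s * θ i) ≤ ∏ i, Real.exp ((s * θ i) ^ 2 / 2) :=
        Finset.prod_le_prod (fun i _ => (Real.cosh_pos _).le)
          fun i _ => Real.cosh_le_exp_half_sq _
    _ = Real.exp (s ^ 2 / 2) := by
        rw [← Real.exp_sum, ← Finset.sum_div]
        simp [mul_pow, ← Finset.mul_sum, h]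

/-- A rotation-invariant probability measure on the sphere is sub-Gaussian with variance proxy
`1 / n`: average the Laplace transform over the sign vectors of the same norm. -/
theorem integral_exp_inner_le {n : ℕ} {σ : Measure (Euc n)} [IsProbabilityMeasure σ]
    (hσsph : σ (sphere (0 : Euc n) 1)ᶜ = 0)
    (hσinv : ∀ e : Euc n ≃ₗᵢ[ℝ] Euc n, σ.map e = σ) {s : ℝ} (hs : 0 ≤ s) {x : Euc n}
    (hx : ‖x‖ = √n * s) :
    ∫ θ, Real.exp ⟪x, θ⟫ ∂σ ≤ Real.exp (s ^ 2 / 2) := by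
  have h : 2 ^ n * ∫ θ, Real.exp ⟪x, θ⟫ ∂σ ≤ 2 ^ n * Real.exp (s ^ 2 / 2) :=
    calc 2 ^ n * ∫ θ, Real.exp ⟪x, θ⟫ ∂σ
        = ∑ p : Fin n → Bool, ∫ θ, Real.exp ⟪signVector s p, θ⟫ ∂σ := by
          rw [Finset.sum_congr rfl fun p _ => (integral_exp_inner_eq_of_norm_eq hσinv
            (hx.trans (norm_signVector hs p).symm)).symm]
          simp
      _ = ∫ θ, ∑ p : Fin n → Bool, Real.exp ⟪signVector s p, θ⟫ ∂σ :=
          (integral_finsetSum _ fun p _ => integrable_exp_inner hσsph _).symm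
      _ ≤ ∫ _θ, 2 ^ n * Real.exp (s ^ 2 / 2) ∂σ := by
          refine integral_mono_ae (integrable_finsetSum _ fun p _ =>
            integrable_exp_inner hσsph _) (integrable_const _) ?_
          filter_upwards [ae_norm_eq_one hσsph] with θ hθ
          simp only [sum_exp_inner_signVector]
          gcongr
          exact prod_cosh_le_exp s hθ
      _ = 2 ^ n * Real.exp (s ^ 2 / 2) := by simp
  exact le_of_mul_le_mul_left h (by positivity)

theorem measureReal_cap_le {n : ℕ} {σ : Measure (Euc n)} [IsProbabilityMeasure σ]
    (hσsph : σ (sphere (0 : Euc n) 1)ᶜ = 0)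
    (hσinv : ∀ e : Euc n ≃ₗᵢ[ℝ] Euc n, σ.map e = σ) {ε : ℝ} (hε : 0 ≤ ε)
    {u : Euc n} (hu : ‖u‖ = 1) :
    σ.real {θ | ε ≤ ⟪u, θ⟫} ≤ Real.exp (-(n * ε ^ 2 / 2)) := by
  have hint : Integrable (fun θ => Real.exp (n * ε * ⟪u, θ⟫)) σ := by
    simpa [real_inner_smul_left] using integrable_exp_inner hσsph ((n * ε) • u)
  have hn : √(n : ℝ) * √n = n := Real.mul_self_sqrt n.cast_nonneg
  have hbound : ∫ θ, Real.exp (n * ε * ⟪u, θ⟫) ∂σ ≤ Real.exp ((√n * ε) ^ 2 / 2) := by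
    have := integral_exp_inner_le hσsph hσinv (s := √n * ε) (by positivity)
      (x := (n * ε) • u) (by
        rw [norm_smul, hu, Real.norm_of_nonneg (by positivity), ← mul_assoc, hn, mul_one])
    simpa only [real_inner_smul_left] using this
  calc σ.real {θ | ε ≤ ⟪u, θ⟫}
      ≤ Real.exp (-(n * ε) * ε) * ∫ θ, Real.exp (n * ε * ⟪u, θ⟫) ∂σ :=
        ProbabilityTheory.measure_ge_le_exp_mul_mgf (X := fun θ => ⟪u, θ⟫) ε
          (by positivity) hint
    _ ≤ Real.exp (-(n * ε) * ε) * Real.exp ((√n * ε) ^ 2 / 2) := by gcongr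
    _ = Real.exp (-(n * ε ^ 2 / 2)) := by
        rw [← Real.exp_add, mul_pow, Real.sq_sqrt n.cast_nonneg]
        ring_nf

theorem mul_norm_le_inner_of_norm_sub_le_one {E : Type*} [NormedAddCommGroup E]
    [InnerProductSpace ℝ E] {x θ : E} {t ε : ℝ} (hε : ε ∈ Set.Ioo (0 : ℝ) 1) (hθ : ‖θ‖ = 1)
    (ht : 1 / √(1 - ε ^ 2) < t) (hx : ‖t • θ - x‖ ≤ 1) :
    ε * ‖x‖ ≤ ⟪x, θ⟫ := by
  obtain ⟨h0, h1⟩ := hε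
  have hpos : 0 < 1 - ε ^ 2 := by nlinarith
  have hsqrt := Real.sqrt_pos.2 hpos
  have ht0 : 0 < t := (by positivity : 0 < 1 / √(1 - ε ^ 2)).trans ht
  have ht2 : 1 < t ^ 2 * (1 - ε ^ 2) := by
    rw [div_lt_iff₀ hsqrt] at ht
    nlinarith [Real.sq_sqrt hpos.le]
  have hsq : ‖t • θ - x‖ ^ 2 ≤ 1 := pow_le_one₀ (norm_nonneg _) hx
  rw [norm_sub_sq_real, norm_smul, hθ, real_inner_smul_left, mul_one, Real.norm_eq_abs,
    sq_abs, real_inner_comm] at hsq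
  have := sq_nonneg (‖x‖ - t * ε)
  nlinarith

theorem exists_cover_coveringNumber {n : ℕ} {K : Set (Euc n)} (hK : IsCompact K) :
    ∃ x : Fin (coveringNumber K (closedBall (0 : Euc n) 1)) → Euc n,
      K ⊆ ⋃ i, x i +ᵥ closedBall (0 : Euc n) 1 := by
  refine Nat.sInf_mem
    (s := {N : ℕ | ∃ x : Fin N → Euc n, K ⊆ ⋃ i, x i +ᵥ closedBall (0 : Euc n) 1}) ?_
  obtain ⟨t, -, htf, hcov⟩ := hK.finite_cover_balls (e := 1) one_pos
  have := htf.fintype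
  refine ⟨Fintype.card t, fun i => ((Fintype.equivFin t).symm i : Euc n), fun y hy => ?_⟩
  obtain ⟨z, hz, hyz⟩ := mem_iUnion₂.1 (hcov hy)
  refine mem_iUnion.2 ⟨Fintype.equivFin t ⟨z, hz⟩, ?_⟩
  simpa using (mem_ball.1 hyz).le

/-- For a convex body `K ⊆ ℝⁿ` with `0 ∈ int K` and covering number `N = N(K, B₂ⁿ)`,
for every `ε ∈ (0,1)` the set of directions `θ ∈ S^{n−1}` with
`ρ_K(θ) ≤ 1/√(1−ε²)` has `σ`-measure at least `1 − 2 e^{log N − nε²/2}`, where `σ` is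
the rotation-invariant probability measure on `S^{n−1}`. -/
theorem radial_function_is_small {n : ℕ}
    (K : Set (Euc n)) (hKcomp : IsCompact K) (hKconv : Convex ℝ K)
    (h0K : 0 ∈ interior K)
    (σ : Measure (Euc n)) [IsProbabilityMeasure σ]
    (hσsph : σ (sphere (0 : Euc n) 1)ᶜ = 0)
    (hσinv : ∀ e : Euc n ≃ₗᵢ[ℝ] Euc n, σ.map e = σ)
    (N : ℕ) (hN : N = coveringNumber K (closedBall (0 : Euc n) 1))
    (ε : ℝ) (hε : ε ∈ Set.Ioo (0 : ℝ) 1) :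
    1 - 2 * Real.exp (Real.log N - n * ε ^ 2 / 2) ≤
      (σ {θ | θ ∈ sphere (0 : Euc n) 1 ∧
        radialFn K θ ≤ 1 / Real.sqrt (1 - ε ^ 2)}).toReal := by
  obtain ⟨x, hx⟩ : ∃ x : Fin N → Euc n, K ⊆ ⋃ i, x i +ᵥ closedBall (0 : Euc n) 1 :=
    hN ▸ exists_cover_coveringNumber hKcomp
  have h0 : (0 : Euc n) ∈ K := interior_subset h0K
  have hNpos : 0 < (N : ℝ) := by
    obtain ⟨i, -⟩ := mem_iUnion.1 (hx h0)
    exact_mod_cast i.pos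
  set A := {θ | θ ∈ sphere (0 : Euc n) 1 ∧ radialFn K θ ≤ 1 / √(1 - ε ^ 2)}
  set c := Real.exp (-(n * ε ^ 2 / 2))
  have hcap (i : Fin N) : σ.real {θ | ‖θ‖ = 1 ∧ ∃ t, 1 / √(1 - ε ^ 2) < t ∧
      ‖t • θ - x i‖ ≤ 1} ≤ c := by
    by_cases hxi : x i = 0
    · refine le_trans (le_of_eq ?_) (Real.exp_pos _).le
      rw [measureReal_eq_zero_iff]
      convert measure_empty (μ := σ)
      refine eq_empty_of_forall_notMem fun θ => ?_
      rintro ⟨hθ, t, ht, hle⟩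
      have hlt : 1 < t := by
        refine lt_of_le_of_lt ?_ ht
        rw [le_div_iff₀ (Real.sqrt_pos.2 (by nlinarith [hε.1, hε.2])), one_mul]
        exact Real.sqrt_le_one.2 (by nlinarith [sq_nonneg ε])
      rw [hxi, sub_zero, norm_smul, hθ, mul_one, Real.norm_eq_abs] at hle
      exact absurd (le_abs_self t) (by linarith)
    · have hpos : 0 < ‖x i‖ := norm_pos_iff.2 hxi
      refine (measureReal_mono ?_).trans
        (measureReal_cap_le hσsph hσinv hε.1.le (u := ‖x i‖⁻¹ • x i) (by
          simp [norm_smul, hpos.ne']))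
      rintro θ ⟨hθ, t, ht, hle⟩
      have := mul_norm_le_inner_of_norm_sub_le_one hε hθ ht hle
      rw [mem_ofPred_eq, real_inner_smul_left, inv_mul_eq_div, le_div_iff₀ hpos]
      exact this
  have hcover : univ ⊆ A ∪ ((sphere (0 : Euc n) 1)ᶜ ∪ ⋃ i, {θ | ‖θ‖ = 1 ∧
      ∃ t, 1 / √(1 - ε ^ 2) < t ∧ ‖t • θ - x i‖ ≤ 1}) := by
    intro θ _
    by_cases hθ : θ ∈ sphere (0 : Euc n) 1
    · by_cases hr : radialFn K θ ≤ 1 / √(1 - ε ^ 2)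
      · exact Or.inl ⟨hθ, hr⟩
      · have hne : {t : ℝ | 0 ≤ t ∧ t • θ ∈ K}.Nonempty := ⟨0, le_rfl, by simpa using h0⟩
        obtain ⟨t, ⟨-, htK⟩, ht⟩ := exists_lt_of_lt_csSup hne (not_le.1 hr)
        obtain ⟨i, hi⟩ := mem_iUnion.1 (hx htK)
        refine Or.inr (Or.inr (mem_iUnion.2 ⟨i, by simpa using hθ, t, ht, ?_⟩))
        simpa [dist_eq_norm] using hi
    · exact Or.inr (Or.inl hθ)
  have hsum : 1 ≤ σ.real A + N * c := by
    calc (1 : ℝ) = σ.real univ := by simp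
      _ ≤ _ := measureReal_mono hcover
      _ ≤ _ := measureReal_union_le _ _
      _ ≤ σ.real A + (0 + ∑ _i : Fin N, c) := by
          gcongr
          refine (measureReal_union_le _ _).trans (add_le_add ?_ ?_)
          · simp [measureReal_def, hσsph]
          · exact (measureReal_iUnion_fintype_le _).trans (Finset.sum_le_sum fun i _ => hcap i)
      _ = σ.real A + N * c := by simp
  rw [sub_eq_add_neg (Real.log N), Real.exp_add, Real.exp_log hNpos]
  have : 0 ≤ N * c := by positivity
  change 1 - 2 * (N * c) ≤ σ.real A
  linarith
end
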